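/- Let α∈(0,2), H∈(0,1) and κ=H−1/α, and suppose κ≥0. Let q>0, b₁∈{−1,1}, F₃∈ℝ, and let F₁,F₂:[0,q]→ℝ be bounded and Lipschitz continuous and satisfy the boundary condition Fᵢ(0) = b₁·Fᵢ(q) for i=1,2. Define K:ℝ→ℝ by K(u) = b₁^{[ln|u|]_q}( F₁({ln|u|}_q)·u₊^κ + F₂({ln|u|}_q)·u₋^κ ) + 1{b₁=1}·1{κ=0}·F₃·ln|u| for u≠0 and K(0)=0. Then ∫₁^{e^q} h^{−αH−1} ( ∫_ℝ |K(u+h)−K(u)|^α du ) dh < ∞. -/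

import Mathlib

open MeasureTheory

/-- `{x}_a = x - a⌊x/a⌋`, the fractional part with period `a`. -/
noncomputable def fpart (a x : ℝ) : ℝ := x - a * ⌊x / a⌋

/-- `u₊^κ`: equals `u^κ` for `u > 0` and `0` for `u ≤ 0`; for `κ = 0` it is the
indicator of `(0,∞)` (via `rpow`). -/
noncomputable def pPow (κ u : ℝ) : ℝ := if 0 < u then u ^ κ else 0

/-- `u₋^κ`: equals `|u|^κ` for `u < 0` and `0` for `u > 0`; for `κ = 0` it is the
indicator of `(-∞,0]` (via `rpow`, since `0 ^ 0 = 1`). -/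
noncomputable def mPow (κ u : ℝ) : ℝ := if u ≤ 0 then |u| ^ κ else 0

theorem fpart_mem_Icc {q : ℝ} (hq : 0 < q) (t : ℝ) : fpart q t ∈ Set.Icc 0 q := by
  have h1 := Int.floor_le (t / q)
  have h2 := Int.lt_floor_add_one (t / q)
  rw [le_div_iff₀ hq] at h1
  rw [div_lt_iff₀ hq] at h2
  unfold fpart
  constructor <;> nlinarith

theorem abs_sign_zpow {b : ℝ} (hb : b = 1 ∨ b = -1) (n : ℤ) : |b ^ n| = 1 := by
  rcases hb with rfl | rfl <;> simp [abs_zpow]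

theorem exists_lipschitz_quasiperiodic {q b C : ℝ} (hq : 0 < q) (hb : b = 1 ∨ b = -1)
    {F : ℝ → ℝ} {L : NNReal} (hbdd : ∀ x ∈ Set.Icc (0 : ℝ) q, |F x| ≤ C)
    (hlip : LipschitzOnWith L F (Set.Icc 0 q)) (hbc : F 0 = b * F q) :
    ∃ A : ℝ, 0 ≤ A ∧ ∀ s t : ℝ, s ≤ t →
      |b ^ ⌊t / q⌋ * F (fpart q t) - b ^ ⌊s / q⌋ * F (fpart q s)| ≤ A * (t - s) := by
  have hC : 0 ≤ C := (abs_nonneg _).trans (hbdd 0 ⟨le_rfl, hq.le⟩)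
  have hb0 : b ≠ 0 := by rcases hb with rfl | rfl <;> norm_num
  have hbb : b * b = 1 := by rcases hb with rfl | rfl <;> norm_num
  have hL : (0 : ℝ) ≤ L := L.2
  have hlip' : ∀ x ∈ Set.Icc (0 : ℝ) q, ∀ y ∈ Set.Icc (0 : ℝ) q, |F x - F y| ≤ L * |x - y| :=
    fun x hx y hy => by simpa [Real.dist_eq] using hlip.dist_le_mul x hx y hy
  have hCq : 0 ≤ 2 * C / q := by positivity
  refine ⟨L + 2 * C / q, by positivity, fun s t hst => ?_⟩
  have hs := fpart_mem_Icc hq s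
  have ht := fpart_mem_Icc hq t
  rcases le_or_gt q (t - s) with hlarge | hsmall
  · have h1 : |b ^ ⌊t / q⌋ * F (fpart q t)| ≤ C := by
      rw [abs_mul, abs_sign_zpow hb, one_mul]; exact hbdd _ ht
    have h2 : |b ^ ⌊s / q⌋ * F (fpart q s)| ≤ C := by
      rw [abs_mul, abs_sign_zpow hb, one_mul]; exact hbdd _ hs
    have h3 : 2 * C ≤ 2 * C / q * (t - s) := by
      rw [div_mul_eq_mul_div, le_div_iff₀ hq]; gcongr
    have h4 := abs_sub (b ^ ⌊t / q⌋ * F (fpart q t)) (b ^ ⌊s / q⌋ * F (fpart q s))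
    nlinarith [mul_nonneg hL (sub_nonneg.2 hst)]
  · have hmono : ⌊s / q⌋ ≤ ⌊t / q⌋ := Int.floor_mono (by gcongr)
    have hle : ⌊t / q⌋ ≤ ⌊s / q⌋ + 1 := by
      rw [← Int.floor_add_one]
      refine Int.floor_mono ?_
      rw [div_add_one hq.ne']
      gcongr
      linarith
    suffices h : |b ^ ⌊t / q⌋ * F (fpart q t) - b ^ ⌊s / q⌋ * F (fpart q s)| ≤ L * (t - s) by
      nlinarith [mul_nonneg hCq (sub_nonneg.2 hst)]
    rcases hmono.eq_or_lt with heq | hlt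
    · rw [← heq, ← mul_sub, abs_mul, abs_sign_zpow hb, one_mul]
      refine (hlip' _ ht _ hs).trans_eq ?_
      have : fpart q t - fpart q s = t - s := by simp only [fpart, heq]; ring
      rw [this, abs_of_nonneg (sub_nonneg.2 hst)]
    · have heq : ⌊t / q⌋ = ⌊s / q⌋ + 1 := by omega
      have hdiff : fpart q t + (q - fpart q s) = t - s := by
        simp only [fpart, heq]; push_cast; ring
      have h1 := hlip' _ ht 0 ⟨le_rfl, hq.le⟩
      have h2 := hlip' q ⟨hq.le, le_rfl⟩ _ hs
      rw [sub_zero, abs_of_nonneg ht.1] at h1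
      rw [abs_of_nonneg (sub_nonneg.2 hs.2)] at h2
      have hsplit : b ^ ⌊t / q⌋ * F (fpart q t) - b ^ ⌊s / q⌋ * F (fpart q s) =
          b ^ ⌊t / q⌋ * (F (fpart q t) - F 0) + b ^ ⌊s / q⌋ * (F q - F (fpart q s)) := by
        rw [heq, zpow_add_one₀ hb0, hbc]
        linear_combination (b ^ ⌊s / q⌋ * F q) * hbb
      rw [hsplit, ← hdiff, mul_add]
      refine (abs_add_le _ _).trans (add_le_add ?_ ?_)
      · rwa [abs_mul, abs_sign_zpow hb, one_mul]
      · rwa [abs_mul, abs_sign_zpow hb, one_mul]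

theorem rpow_sub_rpow_le {κ m n : ℝ} (h0 : 0 ≤ κ) (h1 : κ ≤ 1) (hm : 0 < m) (hmn : m ≤ n) :
    |n ^ κ - m ^ κ| ≤ m ^ (κ - 1) * (n - m) := by
  have hmono : m ^ κ ≤ n ^ κ := Real.rpow_le_rpow hm.le hmn h0
  rw [abs_of_nonneg (sub_nonneg.2 hmono)]
  have hr : 0 ≤ (n - m) / m := div_nonneg (sub_nonneg.2 hmn) hm.le
  have hn : n = m * (1 + (n - m) / m) := by field_simp; ring
  have hber := rpow_one_add_le_one_add_mul_self (by linarith : -1 ≤ (n - m) / m) h0 h1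
  have hmk := Real.rpow_pos_of_pos hm κ
  calc n ^ κ - m ^ κ = m ^ κ * ((1 + (n - m) / m) ^ κ - 1) := by
        conv_lhs => rw [hn, Real.mul_rpow hm.le (by linarith)]
        ring
    _ ≤ m ^ κ * ((n - m) / m) := by
        gcongr; nlinarith
    _ = m ^ (κ - 1) * (n - m) := by rw [Real.rpow_sub_one hm.ne']; ring

theorem log_sub_log_le {m n : ℝ} (hm : 0 < m) (hmn : m ≤ n) :
    Real.log n - Real.log m ≤ (n - m) / m := by
  rw [← Real.log_div (hm.trans_le hmn).ne' hm.ne']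
  refine (Real.log_le_sub_one_of_pos (div_pos (hm.trans_le hmn) hm)).trans_eq ?_
  field_simp

theorem abs_sub_le_rpow_sub_one {κ c A C m n : ℝ} {G : ℝ → ℝ} (h0 : 0 ≤ κ) (h1 : κ ≤ 1)
    (hc : c ≠ 0 → κ = 0) (hA : 0 ≤ A) (hG : ∀ t, |G t| ≤ C)
    (hlip : ∀ s t, s ≤ t → |G t - G s| ≤ A * (t - s)) (hm : 0 < m) (hmn : m ≤ n) :
    |(G (Real.log n) * n ^ κ + c * Real.log n) - (G (Real.log m) * m ^ κ + c * Real.log m)| ≤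
      (A + C + |c|) * m ^ (κ - 1) * (n - m) := by
  have hlog := log_sub_log_le hm hmn
  have hlog0 : 0 ≤ Real.log n - Real.log m := sub_nonneg.2 (Real.log_le_log hm hmn)
  have hmk := Real.rpow_pos_of_pos hm κ
  have hpow : (n - m) / m * m ^ κ = m ^ (κ - 1) * (n - m) := by
    rw [Real.rpow_sub_one hm.ne']; ring
  have e1 : |(G (Real.log n) - G (Real.log m)) * m ^ κ| ≤ A * (m ^ (κ - 1) * (n - m)) := by
    rw [abs_mul, abs_of_pos hmk, ← hpow, ← mul_assoc]
    gcongr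
    exact (hlip _ _ (Real.log_le_log hm hmn)).trans (by gcongr)
  have e2 : |G (Real.log n) * (n ^ κ - m ^ κ)| ≤ C * (m ^ (κ - 1) * (n - m)) := by
    rw [abs_mul]
    exact mul_le_mul (hG _) (rpow_sub_rpow_le h0 h1 hm hmn) (abs_nonneg _)
      ((abs_nonneg _).trans (hG 0))
  have e3 : |c * (Real.log n - Real.log m)| ≤ |c| * (m ^ (κ - 1) * (n - m)) := by
    rw [abs_mul, abs_of_nonneg hlog0]
    rcases eq_or_ne c 0 with rfl | hc0
    · simp
    · gcongr
      rw [← hpow, hc hc0, Real.rpow_zero, mul_one]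
      exact hlog
  calc _ = |(G (Real.log n) - G (Real.log m)) * m ^ κ + G (Real.log n) * (n ^ κ - m ^ κ)
        + c * (Real.log n - Real.log m)| := by congr 1; ring
    _ ≤ _ := (abs_add_three _ _ _).trans (add_le_add (add_le_add e1 e2) e3)
    _ = _ := by ring

theorem abs_log_le_rpow {s x : ℝ} (hs : 0 < s) (hx : 0 < x) :
    |Real.log x| ≤ (x ^ s + x ^ (-s)) / s := by
  have h1 := Real.log_le_rpow_div hx.le hs
  have h2 := Real.log_le_rpow_div (inv_pos.2 hx).le hs
  rw [Real.log_inv, Real.inv_rpow hx.le, ← Real.rpow_neg hx.le] at h2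
  have h3 : 0 ≤ x ^ s / s := by positivity
  have h4 : 0 ≤ x ^ (-s) / s := by positivity
  rw [add_div, abs_le]
  constructor <;> linarith

theorem exists_abs_le_rpow_neg {κ c C R s : ℝ} {G : ℝ → ℝ} (h0 : 0 ≤ κ) (hs : 0 < s)
    (hG : ∀ t, |G t| ≤ C) :
    ∃ D : ℝ, 0 ≤ D ∧ ∀ x, 0 < x → x ≤ R →
      |G (Real.log x) * x ^ κ + c * Real.log x| ≤ D * x ^ (-s) := by
  have hC : 0 ≤ C := (abs_nonneg _).trans (hG 0)
  refine ⟨C * |R| ^ (κ + s) + |c| * ((|R| ^ (s + s) + 1) / s), by positivity,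
    fun x hx hxR => ?_⟩
  have hxR' : x ≤ |R| := hxR.trans (le_abs_self R)
  have key : ∀ r, 0 ≤ r → x ^ r ≤ |R| ^ (r + s) * x ^ (-s) := fun r hr => by
    calc x ^ r = x ^ (r + s) * x ^ (-s) := by rw [← Real.rpow_add hx]; ring_nf
      _ ≤ _ := by gcongr
  rw [add_mul]
  refine (abs_add_le _ _).trans (add_le_add ?_ ?_)
  · rw [abs_mul, abs_of_pos (Real.rpow_pos_of_pos hx κ), mul_assoc]
    exact mul_le_mul (hG _) (key κ h0) (by positivity) hC
  · rw [abs_mul, mul_assoc]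
    gcongr
    refine (abs_log_le_rpow hs hx).trans ?_
    rw [div_mul_eq_mul_div, add_mul, one_mul]
    gcongr
    exact key s hs.le

theorem exists_abs_even_le_rpow_neg {κ c C s : ℝ} {K G₁ G₂ : ℝ → ℝ} (h0 : 0 ≤ κ) (hs : 0 < s)
    (hG₁ : ∀ t, |G₁ t| ≤ C) (hG₂ : ∀ t, |G₂ t| ≤ C)
    (hpos : ∀ u, 0 < u → K u = G₁ (Real.log u) * u ^ κ + c * Real.log u)
    (hneg : ∀ u, 0 < u → K (-u) = G₂ (Real.log u) * u ^ κ + c * Real.log u) (R : ℝ) :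
    ∃ D : ℝ, 0 ≤ D ∧ ∀ v, v ≠ 0 → |v| ≤ R → |K v| ≤ D * |v| ^ (-s) := by
  obtain ⟨D₁, hD₁, h₁⟩ := exists_abs_le_rpow_neg (c := c) (R := R) h0 hs hG₁
  obtain ⟨D₂, hD₂, h₂⟩ := exists_abs_le_rpow_neg (c := c) (R := R) h0 hs hG₂
  refine ⟨D₁ + D₂, by positivity, fun v hv hvR => ?_⟩
  have hp : 0 < |v| ^ (-s) := Real.rpow_pos_of_pos (abs_pos.2 hv) _
  rcases lt_or_gt_of_ne hv with hv | hv
  · rw [abs_of_neg hv] at *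
    have := h₂ (-v) (neg_pos.2 hv) hvR
    rw [← hneg (-v) (neg_pos.2 hv), neg_neg] at this
    nlinarith
  · rw [abs_of_pos hv] at *
    have := h₁ v hv hvR
    rw [← hpos v hv] at this
    nlinarith

theorem exists_abs_increment_le {κ c C A₁ A₂ B : ℝ} {K G₁ G₂ : ℝ → ℝ} (h0 : 0 ≤ κ) (h1 : κ ≤ 1)
    (hc : c ≠ 0 → κ = 0) (hA₁ : 0 ≤ A₁) (hA₂ : 0 ≤ A₂) (hB : 1 ≤ B)
    (hG₁ : ∀ t, |G₁ t| ≤ C) (hG₂ : ∀ t, |G₂ t| ≤ C)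
    (hlip₁ : ∀ s t, s ≤ t → |G₁ t - G₁ s| ≤ A₁ * (t - s))
    (hlip₂ : ∀ s t, s ≤ t → |G₂ t - G₂ s| ≤ A₂ * (t - s))
    (hpos : ∀ u, 0 < u → K u = G₁ (Real.log u) * u ^ κ + c * Real.log u)
    (hneg : ∀ u, 0 < u → K (-u) = G₂ (Real.log u) * u ^ κ + c * Real.log u) :
    ∃ A : ℝ, 0 ≤ A ∧ ∀ u h, 0 < h → h ≤ B → 2 * B ≤ |u| →
      |K (u + h) - K u| ≤ A * (1 + |u|) ^ (κ - 1) := by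
  have hC : 0 ≤ C := (abs_nonneg _).trans (hG₁ 0)
  have key : ∀ {m x h : ℝ}, 1 ≤ x → x / 2 ≤ m → 0 ≤ h → h ≤ B → ∀ {a y : ℝ}, 0 ≤ a → a ≤ A₁ + A₂ →
      y ≤ (a + C + |c|) * m ^ (κ - 1) * h →
      y ≤ (A₁ + A₂ + C + |c|) * (1 / 4) ^ (κ - 1) * B * (1 + x) ^ (κ - 1) := by
    intro m x h hx hm hh0 hh a y ha haA hy
    have hm0 : 0 < m := by linarith
    have hle : m ^ (κ - 1) ≤ (1 / 4) ^ (κ - 1) * (1 + x) ^ (κ - 1) := by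
      rw [← Real.mul_rpow (by norm_num) (by linarith)]
      exact Real.rpow_le_rpow_of_nonpos (by linarith) (by linarith) (by linarith)
    calc y ≤ (a + C + |c|) * m ^ (κ - 1) * h := hy
      _ ≤ (A₁ + A₂ + C + |c|) * ((1 / 4) ^ (κ - 1) * (1 + x) ^ (κ - 1)) * B := by gcongr
      _ = _ := by ring
  refine ⟨(A₁ + A₂ + C + |c|) * (1 / 4) ^ (κ - 1) * B, by positivity, fun u h hh hhB hu => ?_⟩
  rcases lt_or_ge u 0 with hu0 | hu0
  · rw [abs_of_neg hu0] at hu ⊢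
    refine key (m := -u - h) (by linarith) (by linarith) hh.le hhB hA₂ (by linarith) ?_
    have := abs_sub_le_rpow_sub_one h0 h1 hc hA₂ hG₂ hlip₂ (m := -u - h) (n := -u)
      (by linarith) (by linarith)
    rw [← hneg _ (by linarith), ← hneg _ (by linarith), abs_sub_comm] at this
    convert this using 3 <;> ring_nf
  · rw [abs_of_nonneg hu0] at hu ⊢
    refine key (m := u) (by linarith) (by linarith) hh.le hhB hA₁ (by linarith) ?_
    have := abs_sub_le_rpow_sub_one h0 h1 hc hA₁ hG₁ hlip₁ (m := u) (n := u + h)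
      (by linarith) (by linarith)
    rw [← hpos _ (by linarith), ← hpos _ (by linarith)] at this
    convert this using 3; ring

theorem integrableOn_abs_rpow {r : ℝ} (hr : -1 < r) (R : ℝ) :
    IntegrableOn (fun v : ℝ => |v| ^ r) (Set.Icc (-R) R) := by
  rcases lt_or_ge R 0 with hR | hR
  · simp [Set.Icc_eq_empty (by linarith : ¬ -R ≤ R)]
  have h1 : IntervalIntegrable (fun v : ℝ => |v| ^ r) volume 0 R :=
    IntervalIntegrable.congr (fun v hv => by
      rw [Set.uIoc_of_le hR] at hv
      simp only [abs_of_pos hv.1]) (intervalIntegral.intervalIntegrable_rpow' hr)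
  have h2 : IntervalIntegrable (fun v : ℝ => |v| ^ r) volume (-R) 0 := by
    have := ((IntervalIntegrable.iff_comp_neg).1 h1).symm
    simpa using this
  rw [integrableOn_Icc_iff_integrableOn_Ioc,
    ← intervalIntegrable_iff_integrableOn_Ioc_of_le (by linarith)]
  exact h2.trans h1

theorem abs_sub_rpow_le {α x y : ℝ} (hα : 0 ≤ α) :
    |x - y| ^ α ≤ 2 ^ α * (|x| ^ α + |y| ^ α) := by
  have hx := Real.rpow_nonneg (abs_nonneg x) α
  have hy := Real.rpow_nonneg (abs_nonneg y) α
  have hmax : |x - y| ≤ 2 * max |x| |y| := by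
    have := abs_sub x y
    have := le_max_left |x| |y|
    have := le_max_right |x| |y|
    linarith
  calc |x - y| ^ α ≤ (2 * max |x| |y|) ^ α := Real.rpow_le_rpow (abs_nonneg _) hmax hα
    _ = 2 ^ α * (max |x| |y|) ^ α := Real.mul_rpow (by norm_num) (by positivity)
    _ ≤ _ := by
      gcongr
      rcases max_choice |x| |y| with h | h <;> rw [h] <;> linarith

theorem exists_lintegral_increment_le {α B s D A p : ℝ} {K : ℝ → ℝ} (hα : 0 < α) (hD : 0 ≤ D)
    (hA : 0 ≤ A) (hs : s * α < 1) (hp : 1 < p * α)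
    (hlocal : ∀ v, v ≠ 0 → |v| ≤ 3 * B → |K v| ≤ D * |v| ^ (-s))
    (htail : ∀ u h, 0 < h → h ≤ B → 2 * B ≤ |u| → |K (u + h) - K u| ≤ A * (1 + |u|) ^ (-p)) :
    ∃ I : ENNReal, I < ⊤ ∧ ∀ h, 0 < h → h ≤ B →
      ∫⁻ u : ℝ, ENNReal.ofReal (|K (u + h) - K u| ^ α) ≤ I := by
  set g : ℝ → ℝ := (Set.Icc (-(3 * B)) (3 * B)).indicator fun v => D ^ α * |v| ^ (-(s * α)) with hg
  set t : ℝ → ℝ := fun u => A ^ α * (1 + ‖u‖) ^ (-(p * α)) with ht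
  have hgint : Integrable g :=
    (integrable_indicator_iff measurableSet_Icc).2
      ((integrableOn_abs_rpow (by linarith) (3 * B)).const_mul (D ^ α))
  have htint : Integrable t := (integrable_one_add_norm (by simpa using hp)).const_mul _
  have hg0 : ∀ v, 0 ≤ g v := fun v => Set.indicator_nonneg (fun _ _ => by positivity) v
  have ht0 : ∀ v, 0 ≤ t v := fun v => by positivity
  have hKg : ∀ v, v ≠ 0 → |v| ≤ 3 * B → |K v| ^ α ≤ g v := fun v hv hvB => by
    rw [hg, Set.indicator_of_mem (Set.mem_Icc.2 (abs_le.1 hvB)), ← neg_mul, Real.rpow_mul (abs_nonneg v),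
      ← Real.mul_rpow hD (by positivity)]
    exact Real.rpow_le_rpow (abs_nonneg _) (hlocal v hv hvB) hα.le
  refine ⟨ENNReal.ofReal (∫ u, (2 ^ α * (g u + g u) + t u)), ENNReal.ofReal_lt_top,
    fun h hh hhB => ?_⟩
  have hgh : Integrable fun u => g (u + h) := hgint.comp_add_right h
  have hint : Integrable fun u => 2 ^ α * (g (u + h) + g u) + t u :=
    ((hgh.add hgint).const_mul _).add htint
  have hadd : ∀ {f : ℝ → ℝ}, Integrable f →
      ∫ u, (2 ^ α * (f u + g u) + t u) = 2 ^ α * ((∫ u, f u) + ∫ u, g u) + ∫ u, t u := fun hf => by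
    have hfg := hf.add hgint
    rw [← integral_add hf hgint, ← integral_const_mul]
    exact integral_add (hfg.const_mul _) htint
  have heq : ∫ u, (2 ^ α * (g u + g u) + t u) = ∫ u, (2 ^ α * (g (u + h) + g u) + t u) := by
    rw [hadd hgint, hadd hgh, integral_add_right_eq_self g h]
  rw [heq, ofReal_integral_eq_lintegral_ofReal hint (.of_forall fun u => by
    have := hg0 u; have := hg0 (u + h); have := ht0 u; positivity)]
  have hne : ∀ a : ℝ, ∀ᵐ u : ℝ, u ≠ a := fun a => by simp [ae_iff]
  refine lintegral_mono_ae ?_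
  filter_upwards [hne 0, hne (-h)] with u hu0 huh
  refine ENNReal.ofReal_le_ofReal ?_
  rcases le_or_gt (2 * B) |u| with hu | hu
  · have h1 : |K (u + h) - K u| ^ α ≤ t u := by
      rw [ht]
      simp only [Real.norm_eq_abs]
      rw [← neg_mul, Real.rpow_mul (by positivity), ← Real.mul_rpow hA (by positivity)]
      exact Real.rpow_le_rpow (abs_nonneg _) (htail u h hh hhB hu) hα.le
    have h2 : 0 ≤ 2 ^ α * (g (u + h) + g u) := by
      have := hg0 u; have := hg0 (u + h); positivity
    linarith
  · have hu' := abs_lt.1 hu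
    have h1 := hKg u hu0 (by linarith)
    have h2 := hKg (u + h) (fun H => huh (by linarith))
      (abs_le.2 ⟨by linarith, by linarith⟩)
    have h3 : 2 ^ α * (|K (u + h)| ^ α + |K u| ^ α) ≤ 2 ^ α * (g (u + h) + g u) := by gcongr
    linarith [abs_sub_rpow_le (x := K (u + h)) (y := K u) hα.le, ht0 u]

theorem stmt1 (α H κ q b₁ F₃ : ℝ) (hα0 : 0 < α) (hα2 : α < 2)
    (hH0 : 0 < H) (hH1 : H < 1) (hκ : κ = H - 1 / α) (hκ0 : 0 ≤ κ)
    (hq : 0 < q) (hb : b₁ = 1 ∨ b₁ = -1)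
    (F₁ F₂ : ℝ → ℝ) (C : ℝ) (L₁ L₂ : NNReal)
    (hF₁bdd : ∀ x ∈ Set.Icc (0:ℝ) q, |F₁ x| ≤ C)
    (hF₂bdd : ∀ x ∈ Set.Icc (0:ℝ) q, |F₂ x| ≤ C)
    (hF₁lip : LipschitzOnWith L₁ F₁ (Set.Icc (0:ℝ) q))
    (hF₂lip : LipschitzOnWith L₂ F₂ (Set.Icc (0:ℝ) q))
    (hF₁bc : F₁ 0 = b₁ * F₁ q) (hF₂bc : F₂ 0 = b₁ * F₂ q)
    (K : ℝ → ℝ)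
    (hK : ∀ u : ℝ, u ≠ 0 → K u =
      b₁ ^ ⌊Real.log |u| / q⌋ *
        (F₁ (fpart q (Real.log |u|)) * pPow κ u + F₂ (fpart q (Real.log |u|)) * mPow κ u)
      + (if b₁ = 1 then (1:ℝ) else 0) * (if κ = 0 then (1:ℝ) else 0) * F₃ * Real.log |u|)
    (hK0 : K 0 = 0) :
    ∫⁻ h in Set.Ioo (1:ℝ) (Real.exp q),
      ENNReal.ofReal (h ^ (-(α * H) - 1)) *
        ∫⁻ u : ℝ, ENNReal.ofReal (|K (u + h) - K u| ^ α) < ⊤ := by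
  set c : ℝ := (if b₁ = 1 then (1:ℝ) else 0) * (if κ = 0 then (1:ℝ) else 0) * F₃ with hcdef
  have hc : c ≠ 0 → κ = 0 := fun h => by
    by_contra h'
    exact h (by simp [hcdef, h'])
  have hακ : κ * α = H * α - 1 := by rw [hκ]; field_simp
  have hκ1 : κ ≤ 1 := by
    have : 0 < 1 / α := by positivity
    linarith
  have hbound : ∀ {F : ℝ → ℝ}, (∀ x ∈ Set.Icc (0:ℝ) q, |F x| ≤ C) →
      ∀ t, |b₁ ^ ⌊t / q⌋ * F (fpart q t)| ≤ C := fun hF t => by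
    rw [abs_mul, abs_sign_zpow hb, one_mul]
    exact hF _ (fpart_mem_Icc hq t)
  obtain ⟨A₁, hA₁, hlip₁⟩ := exists_lipschitz_quasiperiodic hq hb hF₁bdd hF₁lip hF₁bc
  obtain ⟨A₂, hA₂, hlip₂⟩ := exists_lipschitz_quasiperiodic hq hb hF₂bdd hF₂lip hF₂bc
  have hpos : ∀ u, 0 < u → K u =
      (fun t => b₁ ^ ⌊t / q⌋ * F₁ (fpart q t)) (Real.log u) * u ^ κ + c * Real.log u := by
    intro u hu
    rw [hK u hu.ne', abs_of_pos hu, pPow, mPow, if_pos hu, if_neg hu.not_ge]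
    ring
  have hneg : ∀ u, 0 < u → K (-u) =
      (fun t => b₁ ^ ⌊t / q⌋ * F₂ (fpart q t)) (Real.log u) * u ^ κ + c * Real.log u := by
    intro u hu
    rw [hK (-u) (neg_ne_zero.2 hu.ne'), abs_neg, abs_of_pos hu, pPow, mPow,
      if_neg (by linarith), if_pos (by linarith), abs_neg, abs_of_pos hu]
    ring
  obtain ⟨D, hD, hlocal⟩ := exists_abs_even_le_rpow_neg hκ0 (by positivity : 0 < 1 / (2 * α))
    (hbound hF₁bdd) (hbound hF₂bdd) hpos hneg (3 * Real.exp q)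
  obtain ⟨A, hA, htail⟩ := exists_abs_increment_le hκ0 hκ1 hc hA₁ hA₂
    (Real.one_le_exp hq.le) (hbound hF₁bdd) (hbound hF₂bdd) hlip₁ hlip₂ hpos hneg
  have hs : 1 / (2 * α) * α < 1 := by
    have : 1 / (2 * α) * α = 1 / 2 := by field_simp
    rw [this]; norm_num
  obtain ⟨I, hI, hinner⟩ := exists_lintegral_increment_le (p := 1 - κ) hα0 hD hA hs
    (by nlinarith) hlocal (by simpa using htail)
  calc _ ≤ ∫⁻ _ in Set.Ioo (1:ℝ) (Real.exp q), I := by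
        refine setLIntegral_mono measurable_const fun h hh => ?_
        have h1 : h ^ (-(α * H) - 1) ≤ 1 :=
          Real.rpow_le_one_of_one_le_of_nonpos hh.1.le (by nlinarith)
        calc _ ≤ 1 * I := by
              gcongr
              · simpa using ENNReal.ofReal_le_ofReal h1
              · exact hinner h (by linarith [hh.1]) hh.2.le
          _ = I := one_mul I
    _ < ⊤ := by
        rw [setLIntegral_const, Real.volume_Ioo]
        exact ENNReal.mul_lt_top hI ENNReal.ofReal_lt_top
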